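/- Let Z be a finite set and let d be an integer with 1 ≤ d ≤ |Z| − 1. Then N̄(d) ≥ C(d, ⌊d/2⌋), the binomial coefficient of d choose ⌊d/2⌋. -/

import Mathlib

/-!
STATEMENT 10: `N̄(d) ≥ C(d, ⌊d/2⌋)` for `1 ≤ d ≤ |Z| − 1`.
Here `N̄(d)` is the maximum of `N(E)` over `d`-dimensional exponential
families on `Z`, and `C(d, ⌊d/2⌋) = Nat.choose d (d / 2)`; see the
definitions below.
-/

noncomputable def expFam {Z : Type*} [Fintype Z] (ν : Z → ℝ)
    (F : Set (Z → ℝ)) : Set (Z → ℝ) :=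
  {μ | ∃ f ∈ F, μ = fun z => ν z * Real.exp (f z) / ∑ z', ν z' * Real.exp (f z')}

noncomputable def Feps {Z : Type*} [Fintype Z] (ε : ℝ) (x : Z → ℝ) : Set Z :=
  {z | (⨆ z', x z') - ε ≤ x z}

def distinguishable {Z : Type*} [Fintype Z] (ε : ℝ) (x y : Z → ℝ) : Prop :=
  (Feps ε x \ Feps ε y).Nonempty ∧ (Feps ε y \ Feps ε x).Nonempty

def extremal {Z : Type*} [Fintype Z] (ε : ℝ) (x : Z → ℝ) : Prop :=
  1 - ε ≤ ∑ z, (Feps ε x).indicator x z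

def distinguishProp {Z : Type*} [Fintype Z] (E : Set (Z → ℝ)) (N : ℕ) : Prop :=
  ∃ ε₀ > (0 : ℝ), ∀ ε : ℝ, 0 < ε → ε < ε₀ →
    ∃ A : Finset (Z → ℝ), ↑A ⊆ E ∧ N ≤ A.card ∧
      (∀ π ∈ A, extremal ε π) ∧
      ∀ π ∈ A, ∀ π' ∈ A, π ≠ π' → distinguishable ε π π'

/-- `N(E)`: the maximum `N` such that `distinguishProp E N` holds. -/
noncomputable def NE {Z : Type*} [Fintype Z] (E : Set (Z → ℝ)) : ℕ :=
  sSup {N : ℕ | distinguishProp E N}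

/-- `E` is a `d`-dimensional exponential family on `Z`: `E = E(ν, F)` for some
full-support `ν ∈ P(Z)` and `F` spanned by a minimal basis `ψ₁,…,ψ_d`. -/
def IsExpFamOfDim {Z : Type*} [Fintype Z] (d : ℕ) (E : Set (Z → ℝ)) : Prop :=
  ∃ ν : Z → ℝ, (∀ z, 0 < ν z) ∧ (∑ z, ν z = 1) ∧
    ∃ ψ : Fin d → Z → ℝ, LinearIndependent ℝ (Fin.cons (1 : Z → ℝ) ψ) ∧
      E = expFam ν {f | ∃ r : Fin d → ℝ, f = fun z => ∑ i, r i * ψ i z}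

/-- `N̄(d)`: the maximum of `N(E)` over all `d`-dimensional exponential
families `E` on `Z`. -/
noncomputable def Nbar (Z : Type*) [Fintype Z] (d : ℕ) : ℕ :=
  sSup {n : ℕ | ∃ E : Set (Z → ℝ), IsExpFamOfDim d E ∧ n = NE E}

lemma distinguishProp_le_card {Z : Type*} [Fintype Z] {E : Set (Z → ℝ)} {N : ℕ}
    (h : distinguishProp E N) : N ≤ Nat.card (Set Z) := by
  classical
  obtain ⟨ε₀, hε₀, h⟩ := h
  obtain ⟨A, -, hN, -, hA⟩ := h (ε₀ / 2) (by linarith) (by linarith)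
  rw [Nat.card_eq_fintype_card]
  refine hN.trans (Finset.card_le_card_of_injOn (Feps (ε₀ / 2)) (fun _ _ => Finset.mem_univ _) ?_)
  intro x hx y hy hxy
  by_contra hne
  obtain ⟨⟨z, hz, hz'⟩, -⟩ := hA x hx y hy hne
  exact hz' (hxy ▸ hz)

lemma le_NE_of_distinguishProp {Z : Type*} [Fintype Z] {E : Set (Z → ℝ)} {N : ℕ}
    (h : distinguishProp E N) : N ≤ NE E :=
  le_csSup ⟨_, fun _ => distinguishProp_le_card⟩ h

lemma distinguishProp_zero {Z : Type*} [Fintype Z] (E : Set (Z → ℝ)) : distinguishProp E 0 :=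
  ⟨1, one_pos, fun _ _ _ => ⟨∅, by simp⟩⟩

lemma NE_le_Nbar {Z : Type*} [Fintype Z] {d : ℕ} {E : Set (Z → ℝ)} (hE : IsExpFamOfDim d E) :
    NE E ≤ Nbar Z d := by
  refine le_csSup ⟨Nat.card (Set Z), ?_⟩ ⟨E, hE, rfl⟩
  rintro _ ⟨E', -, rfl⟩
  exact csSup_le ⟨0, distinguishProp_zero E'⟩ fun _ => distinguishProp_le_card

/-- The weight equal to `t` on `S` and to `1` off `S`. -/
noncomputable def setWeight {Z : Type*} (t : ℝ) (S : Set Z) (z : Z) : ℝ :=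
  open Classical in if z ∈ S then t else 1

/-- The distribution proportional to `setWeight t S`. -/
noncomputable def setDist {Z : Type*} [Fintype Z] (t : ℝ) (S : Set Z) (z : Z) : ℝ :=
  setWeight t S z / ∑ z', setWeight t S z'

lemma setWeight_pos {Z : Type*} {t : ℝ} (ht : 1 ≤ t) (S : Set Z) (z : Z) : 0 < setWeight t S z := by
  unfold setWeight
  split_ifs <;> linarith

lemma setWeight_le {Z : Type*} {t : ℝ} (ht : 1 ≤ t) (S : Set Z) (z : Z) : setWeight t S z ≤ t := by
  unfold setWeight
  split_ifs <;> linarith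

section setDist

variable {Z : Type*} [Fintype Z] {t : ℝ} {S : Set Z}

lemma le_sum_setWeight (ht : 1 ≤ t) (hS : S.Nonempty) : t ≤ ∑ z, setWeight t S z := by
  obtain ⟨z, hz⟩ := hS
  calc t = setWeight t S z := by simp [setWeight, hz]
    _ ≤ _ := Finset.single_le_sum (fun i _ => (setWeight_pos ht S i).le) (Finset.mem_univ z)

lemma sum_setWeight_le (ht : 1 ≤ t) (S : Set Z) :
    ∑ z, setWeight t S z ≤ Fintype.card Z * t := by
  simpa using Finset.sum_le_card_nsmul Finset.univ _ t fun z _ => setWeight_le ht S z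

lemma iSup_setDist (ht : 1 ≤ t) (hS : S.Nonempty) :
    ⨆ z, setDist t S z = t / ∑ z, setWeight t S z := by
  have hP := le_sum_setWeight ht hS
  obtain ⟨z, hz⟩ := hS
  have : Nonempty Z := ⟨z⟩
  refine le_antisymm (ciSup_le fun y => ?_) ?_
  · exact div_le_div_of_nonneg_right (setWeight_le ht S y) (by linarith)
  · refine le_ciSup_of_le (Set.finite_range _).bddAbove z ?_
    simp [setDist, setWeight, hz]

lemma Feps_setDist {ε : ℝ} (hε : 0 < ε) (ht : 2 < t) (hεt : ε * Fintype.card Z < 1 / 2)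
    (hS : S.Nonempty) : Feps ε (setDist t S) = S := by
  have ht1 : 1 ≤ t := by linarith
  have hP := le_sum_setWeight ht1 hS
  have hP' := sum_setWeight_le ht1 S
  have hP0 : 0 < ∑ z, setWeight t S z := by linarith
  ext z
  simp only [Feps, Set.mem_ofPred_eq, iSup_setDist ht1 hS]
  by_cases hz : z ∈ S
  · simp [setDist, setWeight, hz, hε.le]
  · simp only [hz, iff_false, not_le, setDist]
    have hw : setWeight t S z = 1 := by simp [setWeight, hz]
    rw [hw, lt_sub_iff_add_lt, ← lt_sub_iff_add_lt', ← sub_div, lt_div_iff₀ hP0]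
    nlinarith [mul_le_mul_of_nonneg_left hP' hε.le]

lemma extremal_setDist {ε : ℝ} (hε : 0 < ε) (ht : 2 < t)
    (hεt : ε * Fintype.card Z < 1 / 2) (htε : Fintype.card Z ≤ ε * t) (hS : S.Nonempty) :
    extremal ε (setDist t S) := by
  classical
  have ht1 : 1 ≤ t := by linarith
  have hP := le_sum_setWeight ht1 hS
  have hP0 : 0 < ∑ z, setWeight t S z := by linarith
  have hterm : ∀ z, (setWeight t S z - 1) / ∑ z', setWeight t S z' ≤
      S.indicator (setDist t S) z := by
    intro z
    by_cases hz : z ∈ S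
    · rw [Set.indicator_of_mem hz, setDist]
      gcongr
      linarith
    · simp [hz, setWeight]
  rw [extremal, Feps_setDist hε ht hεt hS]
  refine le_trans ?_ (Finset.sum_le_sum fun z _ => hterm z)
  rw [← Finset.sum_div, Finset.sum_sub_distrib, le_div_iff₀ hP0]
  simp only [Finset.sum_const, Finset.card_univ, nsmul_eq_mul, mul_one]
  nlinarith [mul_le_mul_of_nonneg_left hP hε.le]

end setDist

/-- The exponential family of the uniform distribution with the indicators of the points
`e i` as basis. -/
noncomputable def pointFam {Z : Type*} [Fintype Z] {d : ℕ} (e : Fin d → Z) : Set (Z → ℝ) :=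
  open Classical in
  expFam (fun _ => (Fintype.card Z : ℝ)⁻¹)
    {f | ∃ r : Fin d → ℝ, f = fun z => ∑ i, r i * (Pi.single (e i) 1 : Z → ℝ) z}

lemma isExpFamOfDim_pointFam {Z : Type*} [Fintype Z] {d : ℕ} {e : Fin d → Z}
    (he : Function.Injective e) {z₀ : Z} (hz₀ : ∀ i, e i ≠ z₀) :
    IsExpFamOfDim d (pointFam e) := by
  classical
  have : Nonempty Z := ⟨z₀⟩
  have hcard : (0 : ℝ) < Fintype.card Z := by exact_mod_cast Fintype.card_pos
  refine ⟨_, fun _ => inv_pos.2 hcard, by simp [hcard.ne'],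
    fun i => Pi.single (e i) 1, ?_, ?_⟩
  · rw [Fintype.linearIndependent_iff]
    intro g hg
    rw [Fin.sum_univ_succ] at hg
    simp only [Fin.cons_zero, Fin.cons_succ] at hg
    have h0 : g 0 = 0 := by
      simpa [Finset.sum_apply, Pi.single_apply, fun i => (hz₀ i).symm] using congrFun hg z₀
    intro i
    refine Fin.cases h0 (fun j => ?_) i
    simpa [Finset.sum_apply, Pi.single_apply, h0, he.eq_iff] using congrFun hg (e j)
  · unfold pointFam
    congr!

lemma setDist_mem_pointFam {Z : Type*} [Fintype Z] {d : ℕ} {e : Fin d → Z}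
    (he : Function.Injective e) {t : ℝ} (ht : 0 < t) (T : Finset (Fin d)) :
    setDist t (e '' T) ∈ pointFam e := by
  classical
  refine ⟨_, ⟨fun i => if i ∈ T then Real.log t else 0, rfl⟩, ?_⟩
  have key : ∀ z, Real.exp (∑ i, (if i ∈ T then Real.log t else 0) *
      (Pi.single (e i) 1 : Z → ℝ) z) = setWeight t (e '' T) z := by
    intro z
    by_cases hz : ∃ i, e i = z
    · obtain ⟨i, rfl⟩ := hz
      by_cases hi : i ∈ T <;>
        simp [setWeight, Pi.single_apply, he.eq_iff, hi, Real.exp_log ht]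
    · push Not at hz
      simp [setWeight, fun i => (hz i).symm, hz]
  funext z
  have : Nonempty Z := ⟨z⟩
  have hcard : (Fintype.card Z : ℝ)⁻¹ ≠ 0 := by simp
  simp only [setDist, ← key, ← Finset.mul_sum]
  rw [mul_div_mul_left _ _ hcard]

lemma distinguishProp_pointFam {Z : Type*} [Fintype Z] {d k : ℕ} {e : Fin d → Z}
    (he : Function.Injective e) (hk : 0 < k) : distinguishProp (pointFam e) (d.choose k) := by
  classical
  refine ⟨1 / (2 * (Fintype.card Z + 1)), by positivity, fun ε hε hε' => ?_⟩
  rw [lt_div_iff₀ (by positivity)] at hε'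
  have hεc : ε * Fintype.card Z < 1 / 2 := by linarith
  obtain ⟨t, ht, hεt⟩ : ∃ t : ℝ, 2 < t ∧ Fintype.card Z ≤ ε * t :=
    ⟨max 3 (Fintype.card Z / ε), lt_max_of_lt_left (by norm_num), by
      rw [← div_le_iff₀' hε]; exact le_max_right _ _⟩
  set P := Finset.powersetCard k (Finset.univ : Finset (Fin d)) with hPdef
  have hne : ∀ T ∈ P, (e '' (T : Set (Fin d))).Nonempty := by
    intro T hT
    rw [Set.image_nonempty, Finset.coe_nonempty, ← Finset.card_pos,
      (Finset.mem_powersetCard.1 hT).2]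
    exact hk
  have hF : ∀ T ∈ P, Feps ε (setDist t (e '' (T : Set (Fin d)))) = e '' T :=
    fun T hT => Feps_setDist hε ht hεc (hne T hT)
  have hsub : ∀ T ∈ P, ∀ T' ∈ P, T ≠ T' →
      (e '' (T : Set (Fin d)) \ e '' (T' : Set (Fin d))).Nonempty := by
    intro T hT T' hT' hTT'
    rw [Set.sdiff_nonempty, Set.image_subset_image_iff he, Finset.coe_subset]
    intro h
    refine hTT' (Finset.eq_of_subset_of_card_le h ?_)
    rw [(Finset.mem_powersetCard.1 hT).2, (Finset.mem_powersetCard.1 hT').2]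
  refine ⟨P.image fun T : Finset (Fin d) => setDist t (e '' (T : Set (Fin d))), ?_, ?_, ?_, ?_⟩
  · intro x hx
    obtain ⟨T, -, rfl⟩ := Finset.mem_image.1 (Finset.mem_coe.1 hx)
    exact setDist_mem_pointFam he (by linarith) T
  · rw [Finset.card_image_of_injOn, hPdef, Finset.card_powersetCard, Finset.card_fin]
    intro T hT T' hT' h
    have h' := congrArg (Feps ε) h
    simp only [hF T hT, hF T' hT'] at h'
    exact Finset.coe_injective (he.image_injective h')
  · simp only [Finset.forall_mem_image]
    exact fun T hT => extremal_setDist hε ht hεc hεt (hne T hT)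
  · simp only [Finset.forall_mem_image]
    intro T hT T' hT' h
    have hTT' : T ≠ T' := fun h' => h (h' ▸ rfl)
    rw [distinguishable, hF T hT, hF T' hT']
    exact ⟨hsub T hT T' hT' hTT', hsub T' hT' T hT hTT'.symm⟩

theorem Nbar_ge_central_binom {Z : Type*} [Fintype Z] (d : ℕ)
    (hd : 1 ≤ d) (hdZ : d ≤ Fintype.card Z - 1) :
    Nat.choose d (d / 2) ≤ Nbar Z d := by
  have hcard : Fintype.card (Fin (d + 1)) ≤ Fintype.card Z := by
    rw [Fintype.card_fin]; omega
  obtain ⟨e⟩ := Function.Embedding.nonempty_of_card_le hcard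
  have he : Function.Injective fun i : Fin d => e i.succ :=
    e.injective.comp (Fin.succ_injective d)
  have hdim := isExpFamOfDim_pointFam he (z₀ := e 0)
    fun i h => Fin.succ_ne_zero i (e.injective h)
  rw [← Nat.choose_symm (Nat.div_le_self d 2)]
  exact (le_NE_of_distinguishProp
    (distinguishProp_pointFam he (by omega))).trans (NE_le_Nbar hdim)
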